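/- Sufficient condition for normality (iv): with the Hartwig–Spindelböck decomposition data as in the context, assuming K is invertible, with A_e := Û · fromBlocks(Σ₁K, Σ₁L, 0, 0) · Û* (the essential part of Â) and A_e^# := Û · fromBlocks(K⁻¹Σ₁⁻¹, K⁻¹Σ₁⁻¹K⁻¹L, 0, 0) · Û* (the group inverse of A_e), if A_e·Â*·A_e^# = A_e^#·A_e·Â*, then Â is normal (Â·Â* = Â*·Â). -/

import Mathlib

open Matrix

/-- The dual complex numbers `𝔻ℂ := ℂ[ε]`, the trivial square-zero extension of `ℂ` by `ℂ`. -/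
abbrev DC := TrivSqZeroExt ℂ ℂ

/-- Star on dual complex numbers: `(a + b·ε)* = conj a + conj b · ε`. -/
instance : Star DC :=
  ⟨fun x => ((starRingEnd ℂ) x.fst, (starRingEnd ℂ) x.snd)⟩

/-- A positive appreciable real dual number: the standard part is a positive real and
the dual part is real. -/
def PosAppreciable (x : DC) : Prop :=
  (∃ a : ℝ, 0 < a ∧ x.fst = (a : ℂ)) ∧ (∃ b : ℝ, x.snd = (b : ℂ))

/-- A nonnegative infinitesimal real dual number: the standard part is `0` and
the dual part is a nonnegative real. -/
def NonnegInfinitesimal (x : DC) : Prop :=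
  x.fst = 0 ∧ ∃ b : ℝ, 0 ≤ b ∧ x.snd = (b : ℂ)

/-- The standard part of a dual complex matrix. -/
def stdPart {m n : Type*} (X : Matrix m n DC) : Matrix m n ℂ :=
  X.map TrivSqZeroExt.fst

/-- The dual part of a dual complex matrix. -/
def dualPart {m n : Type*} (X : Matrix m n DC) : Matrix m n ℂ :=
  X.map TrivSqZeroExt.snd

/-- The componentwise conjugation makes the dual complex numbers a star ring. -/
instance : StarRing DC where
  star_involutive x := by
    apply TrivSqZeroExt.ext
    · exact Complex.conj_conj x.fst
    · exact Complex.conj_conj x.snd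
  star_mul x y := by
    apply TrivSqZeroExt.ext
    · exact (map_mul (starRingEnd ℂ) x.fst y.fst).trans (mul_comm _ _)
    · change (starRingEnd ℂ) (x * y).snd =
        (starRingEnd ℂ) y.fst * (starRingEnd ℂ) x.snd +
          (starRingEnd ℂ) y.snd * (starRingEnd ℂ) x.fst
      simp only [TrivSqZeroExt.snd_mul, smul_eq_mul, MulOpposite.smul_eq_mul_unop,
        MulOpposite.unop_op, map_add, map_mul]
      ring
  star_add x y := by
    apply TrivSqZeroExt.ext
    · exact map_add (starRingEnd ℂ) x.fst y.fst
    · exact map_add (starRingEnd ℂ) x.snd y.snd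

theorem DC.fst_star (x : DC) : (star x).fst = (starRingEnd ℂ) x.fst := rfl

theorem DC.snd_star (x : DC) : (star x).snd = (starRingEnd ℂ) x.snd := rfl

theorem PosAppreciable.star_eq {x : DC} (hx : PosAppreciable x) : star x = x := by
  obtain ⟨⟨a, -, ha⟩, b, hb⟩ := hx
  apply TrivSqZeroExt.ext
  · rw [DC.fst_star, ha, Complex.conj_ofReal]
  · rw [DC.snd_star, hb, Complex.conj_ofReal]

theorem NonnegInfinitesimal.star_eq {x : DC} (hx : NonnegInfinitesimal x) : star x = x := by
  obtain ⟨ha, b, -, hb⟩ := hx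
  apply TrivSqZeroExt.ext
  · rw [DC.fst_star, ha, map_zero]
  · rw [DC.snd_star, hb, Complex.conj_ofReal]

theorem NonnegInfinitesimal.mul_self {x : DC} (hx : NonnegInfinitesimal x) : x * x = 0 := by
  apply TrivSqZeroExt.ext <;> simp [hx.1]

theorem PosAppreciable.isUnit {x : DC} (hx : PosAppreciable x) : IsUnit x := by
  obtain ⟨⟨a, ha, hxa⟩, -⟩ := hx
  rw [TrivSqZeroExt.isUnit_iff_isUnit_fst, hxa, isUnit_iff_ne_zero]
  exact Complex.ofReal_ne_zero.2 (ne_of_gt ha)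

/-- Sufficient condition for normality (iv). -/
theorem normal_of_essential_comm_ii
    {r s : ℕ}
    -- `Û`, a unitary matrix
    (U : Matrix (Fin r ⊕ Fin s) (Fin r ⊕ Fin s) DC)
    (hU₁ : U * Uᴴ = 1) (hU₂ : Uᴴ * U = 1)
    -- the blocks `K, L, M, N` forming a unitary block matrix
    (K : Matrix (Fin r) (Fin r) DC) (L : Matrix (Fin r) (Fin s) DC)
    (M : Matrix (Fin s) (Fin r) DC) (N : Matrix (Fin s) (Fin s) DC)
    (hW₁ : fromBlocks K L M N * (fromBlocks K L M N)ᴴ = 1)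
    (hW₂ : (fromBlocks K L M N)ᴴ * fromBlocks K L M N = 1)
    -- `Σ₁` diagonal with positive appreciable real dual diagonal entries
    (S₁ : Matrix (Fin r) (Fin r) DC) (d₁ : Fin r → DC)
    (hS₁ : S₁ = Matrix.diagonal d₁) (hd₁ : ∀ i, PosAppreciable (d₁ i))
    -- `Σ₂` diagonal with nonnegative infinitesimal real dual diagonal entries
    (S₂ : Matrix (Fin s) (Fin s) DC) (d₂ : Fin s → DC)
    (hS₂ : S₂ = Matrix.diagonal d₂) (hd₂ : ∀ i, NonnegInfinitesimal (d₂ i))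
    -- the Hartwig–Spindelböck decomposition of `Â`
    (A : Matrix (Fin r ⊕ Fin s) (Fin r ⊕ Fin s) DC)
    (hA : A = U * fromBlocks (S₁ * K) (S₁ * L) (S₂ * M) (S₂ * N) * Uᴴ)
    -- `A_e`, the essential part of `Â`
    (Ae : Matrix (Fin r ⊕ Fin s) (Fin r ⊕ Fin s) DC)
    (hAe : Ae = U * fromBlocks (S₁ * K) (S₁ * L) 0 0 * Uᴴ)
    -- `K` is invertible
    (hK : IsUnit K)
    -- `A_e^#`, the group inverse of the essential part
    (Aeg : Matrix (Fin r ⊕ Fin s) (Fin r ⊕ Fin s) DC)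
    (hAeg : Aeg = U * fromBlocks (K⁻¹ * S₁⁻¹) (K⁻¹ * S₁⁻¹ * K⁻¹ * L) 0 0 * Uᴴ)
    (h : Ae * Aᴴ * Aeg = Aeg * Ae * Aᴴ) :
    A * Aᴴ = Aᴴ * A := by
  have hS₁H : S₁ᴴ = S₁ := by
    rw [hS₁, diagonal_conjTranspose]
    exact congrArg _ (funext fun i => (hd₁ i).star_eq)
  have hS₂H : S₂ᴴ = S₂ := by
    rw [hS₂, diagonal_conjTranspose]
    exact congrArg _ (funext fun i => (hd₂ i).star_eq)
  have hS₂sq : S₂ * S₂ = 0 := by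
    rw [hS₂, diagonal_mul_diagonal, ← diagonal_zero]
    exact congrArg _ (funext fun i => (hd₂ i).mul_self)
  have hSdet : IsUnit S₁.det := by
    rw [hS₁, det_diagonal]
    exact (IsUnit.prod_univ_iff).2 fun i => (hd₁ i).isUnit
  have hKdet : IsUnit K.det := (isUnit_iff_isUnit_det K).1 hK
  rw [fromBlocks_conjTranspose, fromBlocks_multiply, ← fromBlocks_one, fromBlocks_inj] at hW₁ hW₂
  obtain ⟨hKL, hKM, -, -⟩ := hW₁
  have hAH : Aᴴ = U * fromBlocks (Kᴴ * S₁) (Mᴴ * S₂) (Lᴴ * S₁) (Nᴴ * S₂) * Uᴴ := by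
    simp only [hA, conjTranspose_mul, conjTranspose_conjTranspose, fromBlocks_conjTranspose,
      hS₁H, hS₂H, Matrix.mul_assoc]
  have conj_mul (X Y : Matrix (Fin r ⊕ Fin s) (Fin r ⊕ Fin s) DC) :
      U * X * Uᴴ * (U * Y * Uᴴ) = U * (X * Y) * Uᴴ := by
    calc U * X * Uᴴ * (U * Y * Uᴴ) = U * X * (Uᴴ * U) * (Y * Uᴴ) := by
          simp only [Matrix.mul_assoc]
      _ = U * (X * Y) * Uᴴ := by simp only [hU₂, Matrix.mul_one, Matrix.mul_assoc]
  have conj_inj {X Y : Matrix (Fin r ⊕ Fin s) (Fin r ⊕ Fin s) DC}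
      (hXY : U * X * Uᴴ = U * Y * Uᴴ) : X = Y := by
    have e (Z : Matrix (Fin r ⊕ Fin s) (Fin r ⊕ Fin s) DC) : Uᴴ * (U * Z * Uᴴ) * U = Z := by
      calc Uᴴ * (U * Z * Uᴴ) * U = (Uᴴ * U) * Z * (Uᴴ * U) := by
            simp only [Matrix.mul_assoc]
        _ = Z := by rw [hU₂, Matrix.one_mul, Matrix.mul_one]
    rw [← e X, hXY, e Y]
  have hAeAH : Ae * Aᴴ = U * fromBlocks (S₁ * S₁) 0 0 0 * Uᴴ := by
    rw [hAe, hAH, conj_mul, fromBlocks_multiply]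
    congr 3
    · calc S₁ * K * (Kᴴ * S₁) + S₁ * L * (Lᴴ * S₁) = S₁ * (K * Kᴴ + L * Lᴴ) * S₁ := by
            simp only [Matrix.mul_add, Matrix.add_mul, Matrix.mul_assoc]
        _ = S₁ * S₁ := by rw [hKL, Matrix.mul_one]
    · calc S₁ * K * (Mᴴ * S₂) + S₁ * L * (Nᴴ * S₂) = S₁ * (K * Mᴴ + L * Nᴴ) * S₂ := by
            simp only [Matrix.mul_add, Matrix.add_mul, Matrix.mul_assoc]
        _ = 0 := by rw [hKM, Matrix.mul_zero, Matrix.zero_mul]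
    · simp
    · simp
  rw [Matrix.mul_assoc Aeg, hAeAH, hAeg, conj_mul, conj_mul] at h
  have h' := conj_inj h
  simp only [fromBlocks_multiply, Matrix.mul_zero, Matrix.zero_mul, add_zero,
    fromBlocks_inj] at h'
  obtain ⟨h₁, h₂, -, -⟩ := h'
  have hL : L = 0 := by
    calc L = K * (S₁ * (K * (S₁⁻¹ * (S₁⁻¹ * (S₁ * S₁ * (K⁻¹ * S₁⁻¹ * K⁻¹ * L)))))) := by
          simp only [Matrix.mul_assoc, nonsing_inv_mul_cancel_left _ _ hSdet,
            mul_nonsing_inv_cancel_left _ _ hSdet, mul_nonsing_inv_cancel_left _ _ hKdet]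
      _ = 0 := by rw [h₂]; simp only [Matrix.mul_zero]
  have hcomm : K * (S₁ * S₁) = S₁ * S₁ * K := by
    calc K * (S₁ * S₁) = K * (S₁ * S₁ * (K⁻¹ * S₁⁻¹)) * S₁ * K := by
          simp only [Matrix.mul_assoc, nonsing_inv_mul_cancel_left _ _ hSdet,
            nonsing_inv_mul _ hKdet, Matrix.mul_one]
      _ = S₁ * S₁ * K := by
          rw [h₁]
          simp only [Matrix.mul_assoc, nonsing_inv_mul_cancel_left _ _ hSdet,
            mul_nonsing_inv_cancel_left _ _ hKdet]
  subst hL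
  have hKK : K * Kᴴ = 1 := by simpa using hKL
  have hKK' : Kᴴ * K = 1 := mul_eq_one_comm.1 hKK
  have hM : M = 0 := by
    have hKM' : K * Mᴴ = 0 := by simpa using hKM
    have : Mᴴ = 0 := by
      rw [← Matrix.one_mul Mᴴ, ← hKK', Matrix.mul_assoc, hKM', Matrix.mul_zero]
    exact conjTranspose_eq_zero.1 this
  subst hM
  have hKSSK : Kᴴ * S₁ * (S₁ * K) = S₁ * S₁ := by
    rw [Matrix.mul_assoc, ← Matrix.mul_assoc S₁, ← hcomm, ← Matrix.mul_assoc, hKK',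
      Matrix.one_mul]
  have hSKKS : S₁ * K * (Kᴴ * S₁) = S₁ * S₁ := by
    rw [Matrix.mul_assoc, ← Matrix.mul_assoc K, hKK, Matrix.one_mul]
  have hNSSN : Nᴴ * S₂ * (S₂ * N) = 0 := by
    rw [Matrix.mul_assoc, ← Matrix.mul_assoc S₂, hS₂sq, Matrix.zero_mul, Matrix.mul_zero]
  have hSNNS : S₂ * N * (Nᴴ * S₂) = 0 := by
    have hN : N * Nᴴ = 1 := mul_eq_one_comm.1 (by simpa using hW₂.2.2.2)
    rw [Matrix.mul_assoc, ← Matrix.mul_assoc N, hN, Matrix.one_mul, hS₂sq]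
  rw [hAH, hA, conj_mul, conj_mul, fromBlocks_multiply, fromBlocks_multiply]
  simp only [hKSSK, hSKKS, hNSSN, hSNNS, conjTranspose_zero, Matrix.mul_zero, Matrix.zero_mul,
    add_zero]
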